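/- If a finite simple graph H is r-rainbow common for some integer r ≥ e(H), then H is a forest (contains no cycle). -/

import Mathlib

open Finset

/-- The edge set of the complete graph `K_n` on vertex set `Fin n`,
encoded as ordered pairs `(u, v)` with `u < v`. -/
abbrev KEdge (n : ℕ) : Type := {q : Fin n × Fin n // q.1 < q.2}

/-- The number of rainbow copies of `H` in `K_n` under the edge coloring `φ`:
the number of subgraphs of `K_n` that are isomorphic to `H` and all of whose
edges receive pairwise distinct colors under `φ`. -/
noncomputable def rainbowCount {p : ℕ} (H : SimpleGraph (Fin p)) {n r : ℕ}
    (φ : KEdge n → Fin r) : ℕ :=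
  Nat.card {S : (⊤ : SimpleGraph (Fin n)).Subgraph //
    Nonempty (H ≃g S.coe) ∧ Set.InjOn φ {q : KEdge n | S.Adj q.val.1 q.val.2}}

/-- The character `s ↦ s u * s v` of the group of sign vectors attached to the pair `s(u, v)`. -/
def edgeSign {V : Type*} (e : Sym2 V) : (V → ℤˣ) →* ℤˣ where
  toFun s := (e.map s).mul
  map_one' := by induction e with | _ u v => simp
  map_mul' s t := by
    induction e with | _ u v => simp [mul_mul_mul_comm]

lemma edgeSign_mk {V : Type*} (u v : V) (s : V → ℤˣ) : edgeSign s(u, v) s = s u * s v := by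
  simp [edgeSign]

lemma edgeSign_map {V W : Type*} (f : V → W) (e : Sym2 V) (s : W → ℤˣ) :
    edgeSign (e.map f) s = edgeSign e (s ∘ f) := by
  induction e with | _ u v => simp [edgeSign_mk]

/-- A set of edges is balanced if the product of its edge characters is trivial,
i.e. if it is an element of the cycle space modulo two. -/
def IsBalanced {V : Type*} (F : Finset (Sym2 V)) : Prop :=
  ∏ e ∈ F, edgeSign e = 1

lemma prod_edgeSign_edges {V : Type*} {G : SimpleGraph V} {u v : V} (w : G.Walk u v)
    (s : V → ℤˣ) : (w.edges.map fun e => edgeSign e s).prod = s u * s v := by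
  induction w with
  | nil => simp [Int.units_mul_self]
  | @cons a b c h w ih =>
    rw [SimpleGraph.Walk.edges_cons, List.map_cons, List.prod_cons, ih, edgeSign_mk, mul_assoc,
      ← mul_assoc (s b), Int.units_mul_self, one_mul]

lemma isBalanced_edges_of_isTrail {V : Type*} [DecidableEq V] {G : SimpleGraph V} {u : V}
    {w : G.Walk u u} (hw : w.IsTrail) : IsBalanced w.edges.toFinset := by
  ext s
  rw [MonoidHom.finsetProd_apply, List.prod_toFinset _ hw.edges_nodup, prod_edgeSign_edges,
    Int.units_mul_self, MonoidHom.one_apply]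

/-- A nonempty balanced set of non-loops has at least three elements. -/
lemma IsBalanced.three_le_card {V : Type*} [DecidableEq V] {F : Finset (Sym2 V)}
    (hF : IsBalanced F) (hne : F.Nonempty) (hdiag : ∀ e ∈ F, ¬ e.IsDiag) : 3 ≤ F.card := by
  have key (x : V) : ∏ e ∈ F, edgeSign e (Pi.mulSingle x (-1)) = 1 := by
    rw [← MonoidHom.finsetProd_apply, show ∏ e ∈ F, edgeSign e = 1 from hF, MonoidHom.one_apply]
  have hmem (x : V) (e : Sym2 V) (he : ¬ e.IsDiag) (hx : x ∈ e) :
      edgeSign e (Pi.mulSingle x (-1)) = -1 := by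
    obtain ⟨y, rfl⟩ := Sym2.mem_iff_exists.1 hx
    have hxy : y ≠ x := fun h => he (by simp [h])
    simp [edgeSign_mk, Pi.mulSingle_eq_of_ne hxy]
  have hnot (x : V) (e : Sym2 V) (hx : x ∉ e) : edgeSign e (Pi.mulSingle x (-1)) = 1 := by
    induction e with
    | _ u v =>
      simp only [Sym2.mem_iff, not_or] at hx
      rw [edgeSign_mk, Pi.mulSingle_eq_of_ne (Ne.symm hx.1), Pi.mulSingle_eq_of_ne (Ne.symm hx.2),
        one_mul]
  by_contra! hlt
  have h0 := hne.card_pos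
  have h12 : F.card = 1 ∨ F.card = 2 := by omega
  rcases h12 with h1 | h2
  · obtain ⟨e, rfl⟩ := card_eq_one.1 h1
    induction e with
    | _ u v =>
      have := key u
      rw [prod_singleton, hmem u _ (hdiag _ (by simp)) (by simp)] at this
      exact absurd this (by decide)
  · obtain ⟨e, f, hef, rfl⟩ := card_eq_two.1 h2
    have hex : ∃ x ∈ e, x ∉ f := by
      by_contra! hsub
      induction e with
      | _ u v =>
        have huv : u ≠ v := fun h => hdiag s(u, v) (by simp) (by simp [h])
        exact hef ((Sym2.mem_and_mem_iff huv).1 ⟨hsub u (by simp), hsub v (by simp)⟩).symm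
    obtain ⟨x, hxe, hxf⟩ := hex
    have := key x
    rw [prod_pair hef, hmem x _ (hdiag _ (by simp)) hxe, hnot x _ hxf] at this
    exact absurd this (by decide)

open Classical in
/-- Averaging over all sign vectors detects balanced edge sets. -/
lemma sum_prod_edgeSign_map {V W : Type*} [Fintype W] (f : V ↪ W) (F : Finset (Sym2 V)) :
    ∑ s : W → ℤˣ, ∏ e ∈ F, (((edgeSign (e.map f) s : ℤˣ) : ℤ) : ℝ) =
      if IsBalanced F then (2 : ℝ) ^ Fintype.card W else 0 := by
  let ψ : (W → ℤˣ) →* ℝ :=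
    ((Int.castRingHom ℝ).toMonoidHom.comp (Units.coeHom ℤ)).comp
      (∏ e ∈ F, edgeSign (e.map f))
  have hψ (s : W → ℤˣ) : ψ s = ∏ e ∈ F, (((edgeSign (e.map f) s : ℤˣ) : ℤ) : ℝ) := by
    simp [ψ, MonoidHom.finsetProd_apply]
  have hone : ψ = 1 ↔ IsBalanced F := by
    have h1 : ψ = 1 ↔ ∀ s : W → ℤˣ, ∏ e ∈ F, edgeSign e (s ∘ f) = 1 := by
      rw [MonoidHom.ext_iff]
      refine forall_congr' fun s => ?_
      simp only [ψ, MonoidHom.comp_apply, MonoidHom.finsetProd_apply, edgeSign_map,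
        MonoidHom.one_apply]
      simp [← Units.coe_prod]
    rw [h1, IsBalanced, MonoidHom.ext_iff,
      (f.injective.surjective_comp_right (γ := ℤˣ)).forall]
    simp [MonoidHom.finsetProd_apply]
  simp_rw [← hψ]
  simp only [sum_hom_units, hone]
  simp

open Classical in
/-- If the colors `φ q` are drawn independently with distributions `w q`, then the probability that
the cells `j e` get distinct colors is the sum over all injective colorings. -/
lemma sum_prod_weight_injective {ι κ α : Type*} [Fintype ι] [Fintype κ] [Fintype α]
    (j : ι → κ) (hj : Function.Injective j) (w : κ → α → ℝ) (hw : ∀ q, ∑ i, w q i = 1) :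
    ∑ φ : κ → α, (∏ q, w q (φ q)) * (if Function.Injective (φ ∘ j) then 1 else 0) =
      ∑ c : ι ↪ α, ∏ e, w (j e) (c e) := by
  have hind (φ : κ → α) : (if Function.Injective (φ ∘ j) then (1 : ℝ) else 0) =
      ∑ c : ι ↪ α, if φ ∘ j = c then 1 else 0 := by
    split_ifs with h
    · rw [sum_eq_single (⟨φ ∘ j, h⟩ : ι ↪ α)]
      · simp
      · exact fun c _ hc => if_neg fun h' => hc (DFunLike.coe_injective h'.symm)
      · simp
    · exact (sum_eq_zero fun c _ => if_neg fun h' => h (by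
        rw [h']
        exact c.injective)).symm
  have hfix (c : ι → α) :
      ∑ φ : κ → α, (∏ q, w q (φ q)) * (if φ ∘ j = c then 1 else 0) = ∏ e, w (j e) (c e) := by
    have h1 (φ : κ → α) : (∏ q, w q (φ q)) * (if φ ∘ j = c then 1 else 0) =
        ∏ q, w q (φ q) * (if ∀ e, j e = q → φ q = c e then 1 else 0) := by
      rw [prod_mul_distrib, prod_boole]
      congr 2
      simp only [funext_iff, Function.comp_apply, mem_univ, true_imp_iff, eq_iff_iff]
      exact ⟨fun h q e he => he ▸ h e, fun h e => h _ e rfl⟩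
    simp_rw [h1]
    rw [← Fintype.prod_sum (fun q i => w q i * (if ∀ e, j e = q → i = c e then (1 : ℝ) else 0)),
      ← prod_subset (subset_univ (univ.image j)), prod_image hj.injOn]
    · refine prod_congr rfl fun e _ => ?_
      rw [sum_eq_single (c e)]
      · simp +contextual [hj.eq_iff]
      · exact fun i _ hi => by rw [if_neg fun h => hi (h e rfl), mul_zero]
      · simp
    · intro q _ hq
      refine Eq.trans ?_ (hw q)
      refine sum_congr rfl fun i _ => ?_
      rw [if_pos fun e he => absurd (mem_image.2 ⟨e, mem_univ e, he⟩) hq, mul_one]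
  simp_rw [hind, mul_sum]
  rw [sum_comm]
  exact sum_congr rfl fun c _ => hfix c

/-- A perturbation vector with zero sum and prescribed support, whose entries have a positive
product over the support. -/
lemma exists_perturbation {α : Type*} [Fintype α] [DecidableEq α] (A : Finset α)
    (hA : 3 ≤ A.card) {δ : ℝ} (hδ : 0 < δ) :
    ∃ b : α → ℝ, ∑ i, b i = 0 ∧ (∀ i ∉ A, b i = 0) ∧ 0 < ∏ i ∈ A, b i ∧ ∀ i, |b i| ≤ δ := by
  obtain ⟨B, hBA, hB⟩ := exists_subset_card_eq (show 2 ≤ A.card by omega)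
  obtain ⟨m, hm⟩ : ∃ m, A.card = m + 3 := ⟨A.card - 3, by omega⟩
  have hm' : (A \ B).card = m + 1 := by rw [card_sdiff_of_subset hBA]; omega
  let t : ℝ := 2 * δ / (m + 3)
  have ht : 0 < t := by positivity
  let b : α → ℝ := fun i => if i ∈ B then -((m + 1) / 2 * t) else if i ∈ A then t else 0
  have hbB : ∀ i ∈ B, b i = -((m + 1) / 2 * t) := fun i hi => if_pos hi
  have hbA : ∀ i ∈ A \ B, b i = t := fun i hi => by
    rw [mem_sdiff] at hi
    simp [b, hi]
  have hb0 : ∀ i ∉ A, b i = 0 := fun i hi => by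
    rw [show b i = _ from if_neg fun h => hi (hBA h), if_neg hi]
  refine ⟨b, ?_, hb0, ?_, ?_⟩
  · rw [← sum_subset (subset_univ A) fun i _ hi => hb0 i hi, ← sum_sdiff hBA, sum_congr rfl hbA,
      sum_congr rfl hbB, sum_const, sum_const, hm', hB]
    push_cast [nsmul_eq_mul]
    ring
  · rw [← prod_sdiff hBA, prod_congr rfl hbA, prod_congr rfl hbB, prod_const, prod_const, hm', hB]
    have : 0 < (m + 1 : ℝ) / 2 * t := by positivity
    rw [neg_sq]
    positivity
  · have htm : t * (m + 3) = 2 * δ := by simp only [t]; field_simp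
    have hmt : 0 ≤ m * t := by positivity
    intro i
    by_cases hi : i ∈ B
    · rw [hbB i hi, abs_neg, abs_of_nonneg (by positivity)]
      nlinarith
    · by_cases hi' : i ∈ A
      · rw [hbA i (mem_sdiff.2 ⟨hi', hi⟩), abs_of_pos ht]
        nlinarith
      · rw [hb0 i hi', abs_zero]
        exact hδ.le

open Classical in
/-- The probability that a fixed copy of the edge set `E` is rainbow, when a uniformly random sign
vector `s` is drawn and an edge `q` gets color `i` with probability `1 / r + b i * edgeSign q s`. -/
noncomputable def rainbowDensity {V : Type*} (E : Finset (Sym2 V)) {r : ℕ} (b : Fin r → ℝ) : ℝ :=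
  ∑ c : E ↪ Fin r, ∑ F : Finset E,
    if IsBalanced (F.map (Function.Embedding.subtype _)) then
      (∏ e ∈ F, b (c e)) * (1 / r : ℝ) ^ (Fᶜ).card else 0

open Classical in
lemma sum_sum_prod_weight {V W : Type*} [Fintype W] (E : Finset (Sym2 V)) {r : ℕ} (hr : r ≠ 0)
    (b : Fin r → ℝ) (hb : ∑ i, b i = 0) (ψ : V ↪ W) :
    ∑ s : W → ℤˣ, ∑ φ : Sym2 W → Fin r,
      (∏ q, (1 / r + b (φ q) * ((edgeSign q s : ℤˣ) : ℤ) : ℝ)) *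
        (if Function.Injective (fun e : E => φ (e.1.map ψ)) then 1 else 0) =
      2 ^ Fintype.card W * rainbowDensity E b := by
  have hr' : (r : ℝ) ≠ 0 := by exact_mod_cast hr
  have hj : Function.Injective (fun e : E => e.1.map ψ) :=
    (Sym2.map.injective ψ.injective).comp Subtype.val_injective
  have h1 (s : W → ℤˣ) : ∑ φ : Sym2 W → Fin r,
      (∏ q, (1 / r + b (φ q) * ((edgeSign q s : ℤˣ) : ℤ) : ℝ)) *
        (if Function.Injective (fun e : E => φ (e.1.map ψ)) then 1 else 0) =
      ∑ c : E ↪ Fin r, ∏ e : E, (1 / r + b (c e) * ((edgeSign (e.1.map ψ) s : ℤˣ) : ℤ) : ℝ) := by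
    convert sum_prod_weight_injective (α := Fin r) (fun e : E => e.1.map ψ) hj
      (fun q i => (1 / r + b i * ((edgeSign q s : ℤˣ) : ℤ) : ℝ)) (fun q => by
        rw [sum_add_distrib, ← sum_mul, hb]
        simp [hr'])
    rfl
  simp_rw [h1]
  rw [sum_comm, rainbowDensity, mul_sum]
  refine sum_congr rfl fun c _ => ?_
  simp_rw [add_comm (1 / r : ℝ), Fintype.prod_add, prod_mul_distrib, prod_const]
  rw [sum_comm, mul_sum]
  refine sum_congr rfl fun F _ => ?_
  have h2 := sum_prod_edgeSign_map ψ (F.map (Function.Embedding.subtype _))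
  simp only [prod_map, Function.Embedding.subtype_apply] at h2
  simp_rw [mul_right_comm]
  rw [← mul_sum, h2]
  split_ifs <;> ring

open Classical in
/-- If `E` contains a nonempty balanced set then some perturbation of the uniform distribution
beats the rainbow density of the uniform random coloring. -/
lemma exists_lt_rainbowDensity {V : Type*} (E : Finset (Sym2 V)) {r : ℕ}
    (hr : E.card ≤ r) (hE : ∀ e ∈ E, ¬ e.IsDiag)
    (hbal : ∃ F ⊆ E, F.Nonempty ∧ IsBalanced F) :
    ∃ b : Fin r → ℝ, ∑ i, b i = 0 ∧ (∀ i, |b i| ≤ 1 / r) ∧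
      (r.descFactorial E.card : ℝ) / r ^ E.card < rainbowDensity E b := by
  let P : Finset E → Prop := fun F =>
    F.Nonempty ∧ IsBalanced (F.map (Function.Embedding.subtype _))
  obtain ⟨F₀, hF₀, hmin⟩ : ∃ F₀ : Finset E, P F₀ ∧ ∀ F, P F → F₀.card ≤ F.card := by
    have hP : (univ.filter P).Nonempty := by
      obtain ⟨F, hFE, hF, hFb⟩ := hbal
      refine ⟨F.subtype (· ∈ E), ?_⟩
      have hmap : (F.subtype (· ∈ E)).map (Function.Embedding.subtype _) = F :=
        subtype_map_of_mem hFE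
      refine mem_filter.2 ⟨mem_univ _, ?_, ?_⟩
      · rwa [← map_nonempty (f := Function.Embedding.subtype _), hmap]
      · rwa [hmap]
    obtain ⟨F₀, h1, h2⟩ := exists_min_image _ card hP
    exact ⟨F₀, (mem_filter.1 h1).2, fun F hF => h2 F (mem_filter.2 ⟨mem_univ _, hF⟩)⟩
  have hcard : 3 ≤ F₀.card := by
    rw [← card_map (Function.Embedding.subtype _)]
    refine hF₀.2.three_le_card (hF₀.1.map) fun e he => ?_
    obtain ⟨e', -, rfl⟩ := mem_map.1 he
    exact hE _ e'.2
  have hFE : F₀.card ≤ E.card := by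
    simpa using card_le_univ F₀
  have hr0 : (0 : ℝ) < 1 / r := by
    have : (0 : ℝ) < r := by exact_mod_cast (by omega : 0 < r)
    positivity
  obtain ⟨c₀⟩ : Nonempty (E ↪ Fin r) :=
    Function.Embedding.nonempty_of_card_le (by simpa using hr)
  obtain ⟨b, hb0, hbA, hbpos, hbd⟩ :=
    exists_perturbation (F₀.map c₀) (by rwa [card_map]) hr0
  refine ⟨b, hb0, hbd, ?_⟩
  have hprod (c : E ↪ Fin r) (F : Finset E) (hF : P F) : 0 ≤ ∏ e ∈ F, b (c e) := by
    by_cases h : F.map c ⊆ F₀.map c₀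
    · have : F.map c = F₀.map c₀ := eq_of_subset_of_card_le h (by
        rw [card_map, card_map]
        exact hmin F hF)
      rw [← this, prod_map] at hbpos
      exact hbpos.le
    · obtain ⟨i, hi, hi'⟩ := not_subset.1 h
      obtain ⟨e, he, rfl⟩ := mem_map.1 hi
      exact (prod_eq_zero he (hbA _ hi')).ge
  let g : (E ↪ Fin r) → Finset E → ℝ := fun c F =>
    if IsBalanced (F.map (Function.Embedding.subtype _)) then
      (∏ e ∈ F, b (c e)) * (1 / r : ℝ) ^ (Fᶜ).card else 0
  have hempty (c : E ↪ Fin r) : g c ∅ = (1 / r : ℝ) ^ E.card := by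
    simp [g, IsBalanced]
  have hg (c : E ↪ Fin r) (F : Finset E) (hF : F ≠ ∅) : 0 ≤ g c F := by
    dsimp only [g]
    split_ifs with h
    · exact mul_nonneg (hprod c F ⟨nonempty_iff_ne_empty.2 hF, h⟩) (pow_nonneg hr0.le _)
    · exact le_rfl
  have hg0 : 0 < g c₀ F₀ := by
    dsimp only [g]
    rw [if_pos hF₀.2]
    rw [prod_map] at hbpos
    exact mul_pos hbpos (pow_pos hr0 _)
  have hsplit (c : E ↪ Fin r) :
      ∑ F : Finset E, g c F = (1 / r : ℝ) ^ E.card + ∑ F ∈ univ.erase ∅, g c F := by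
    rw [← add_sum_erase _ _ (mem_univ (∅ : Finset E)), hempty]
  have hrest (c : E ↪ Fin r) : 0 ≤ ∑ F ∈ univ.erase ∅, g c F :=
    sum_nonneg fun F hF => hg c F (ne_of_mem_erase hF)
  calc (r.descFactorial E.card : ℝ) / r ^ E.card
      = ∑ _c : E ↪ Fin r, (1 / r : ℝ) ^ E.card := by
        rw [sum_const, card_univ, Fintype.card_embedding_eq]
        simp [div_eq_mul_inv]
    _ < ∑ c : E ↪ Fin r, ∑ F : Finset E, g c F := by
        refine sum_lt_sum (fun c _ => ?_) ⟨c₀, mem_univ _, ?_⟩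
        · rw [hsplit]
          exact le_add_of_nonneg_right (hrest c)
        · rw [hsplit]
          refine lt_add_of_pos_right _ (sum_pos' (fun F hF => hg c₀ F (ne_of_mem_erase hF))
            ⟨F₀, mem_erase.2 ⟨hF₀.1.ne_empty, mem_univ _⟩, hg0⟩)
    _ = rainbowDensity E b := rfl

instance finite_rainbow_copies {p : ℕ} (H : SimpleGraph (Fin p)) {n r : ℕ}
    (φ : KEdge n → Fin r) :
    Finite {S : (⊤ : SimpleGraph (Fin n)).Subgraph //
      Nonempty (H ≃g S.coe) ∧ Set.InjOn φ {q : KEdge n | S.Adj q.val.1 q.val.2}} := by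
  classical
  infer_instance

lemma rainbowCount_le_pow {p : ℕ} (H : SimpleGraph (Fin p)) {n r : ℕ} (φ : KEdge n → Fin r) :
    rainbowCount H φ ≤ n ^ p := by
  have h (S : {S : (⊤ : SimpleGraph (Fin n)).Subgraph //
      Nonempty (H ≃g S.coe) ∧ Set.InjOn φ {q : KEdge n | S.Adj q.val.1 q.val.2}}) :
      ∃ f : SimpleGraph.Copy H ⊤, f.toSubgraph = S.1 := by
    have : S.1 ∈ Set.range (SimpleGraph.Copy.toSubgraph (A := H)) := by
      rw [SimpleGraph.Copy.range_toSubgraph]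
      exact S.2.1
    exact this
  choose f hf using h
  have hinj : Function.Injective fun S => (f S : Fin p → Fin n) := fun S T hST => by
    apply Subtype.ext
    rw [← hf S, ← hf T, DFunLike.coe_injective hST]
  calc rainbowCount H φ ≤ Nat.card (Fin p → Fin n) := Nat.card_le_card_of_injective _ hinj
    _ = n ^ p := by simp

lemma card_rainbow_embeddings_le {p : ℕ} (H : SimpleGraph (Fin p)) [DecidableRel H.Adj] {n r : ℕ}
    (φ : Sym2 (Fin n) → Fin r) :
    Nat.card {ψ : Fin p ↪ Fin n //
        Function.Injective fun e : H.edgeFinset => φ (e.1.map ψ)} ≤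
      rainbowCount H (fun q : KEdge n => φ s(q.val.1, q.val.2)) * Nat.card (H ≃g H) := by
  set T := {S : (⊤ : SimpleGraph (Fin n)).Subgraph // Nonempty (H ≃g S.coe) ∧
    Set.InjOn (fun q : KEdge n => φ s(q.val.1, q.val.2)) {q : KEdge n | S.Adj q.val.1 q.val.2}}
    with hT
  let σ (S : T) : H ≃g S.1.coe := S.2.1.some
  have key (ψ : {ψ : Fin p ↪ Fin n //
      Function.Injective fun e : H.edgeFinset => φ (e.1.map ψ)}) :
      ∃ x : T × (H ≃g H), ∀ i, (σ x.1 (x.2 i) : Fin n) = ψ.1 i := by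
    obtain ⟨ψ, hψ⟩ := ψ
    let C : SimpleGraph.Copy H (⊤ : SimpleGraph (Fin n)) :=
      ⟨⟨ψ, fun h => ψ.injective.ne h.ne⟩, ψ.injective⟩
    have hadj (q : KEdge n) (hq : C.toSubgraph.Adj q.1.1 q.1.2) :
        ∃ e : H.edgeFinset, e.1.map ψ = s(q.1.1, q.1.2) := by
      obtain ⟨x, y, hxy, hx, hy⟩ := hq
      refine ⟨⟨s(x, y), ?_⟩, ?_⟩
      · simpa using hxy
      · rw [← hx, ← hy]
        rfl
    have hinj : Set.InjOn (fun q : KEdge n => φ s(q.val.1, q.val.2))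
        {q : KEdge n | C.toSubgraph.Adj q.val.1 q.val.2} := by
      intro q hq q' hq' h
      obtain ⟨e, he⟩ := hadj q hq
      obtain ⟨e', he'⟩ := hadj q' hq'
      have hee : e = e' := hψ (by simpa only [he, he'] using h)
      subst hee
      have hs : s(q.1.1, q.1.2) = s(q'.1.1, q'.1.2) := he.symm.trans he'
      rcases Sym2.eq_iff.1 hs with ⟨h1, h2⟩ | ⟨h1, h2⟩
      · exact Subtype.ext (Prod.ext h1 h2)
      · have hlt := q.2
        rw [h1, h2] at hlt
        exact absurd hlt q'.2.asymm
    let S : T := ⟨C.toSubgraph, ⟨C.isoToSubgraph⟩, hinj⟩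
    refine ⟨(S, C.isoToSubgraph.trans (σ S).symm), fun i => ?_⟩
    change ((σ S ((σ S).symm (C.isoToSubgraph i))) : Fin n) = ψ i
    rw [RelIso.apply_symm_apply]
    rfl
  choose g hg using key
  have hginj : Function.Injective g := fun ψ ψ' h => by
    refine Subtype.ext (DFunLike.ext _ _ fun i => ?_)
    rw [← hg, ← hg, h]
  have hfin : Finite (H ≃g H) := DFunLike.finite _
  calc _ ≤ Nat.card (T × (H ≃g H)) := Nat.card_le_card_of_injective g hginj
    _ = _ := Nat.card_prod _ _

/-- First moment bound: some coloring has at least the expected number of rainbow copies. -/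
lemma descFactorial_mul_rainbowDensity_le {p : ℕ} (H : SimpleGraph (Fin p)) [DecidableRel H.Adj]
    {r : ℕ} (hr : r ≠ 0) (b : Fin r → ℝ) (hb : ∑ i, b i = 0) (hbd : ∀ i, |b i| ≤ 1 / r)
    (n : ℕ) (M : ℝ) (hM : ∀ φ : KEdge n → Fin r, (rainbowCount H φ : ℝ) ≤ M) :
    n.descFactorial p * rainbowDensity H.edgeFinset b ≤ M * Nat.card (H ≃g H) := by
  classical
  let w (s : Fin n → ℤˣ) (φ : Sym2 (Fin n) → Fin r) : ℝ :=
    ∏ q, (1 / r + b (φ q) * ((edgeSign q s : ℤˣ) : ℤ) : ℝ)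
  have hr' : (r : ℝ) ≠ 0 := by exact_mod_cast hr
  have hw (s φ) : 0 ≤ w s φ := prod_nonneg fun q _ => by
    have h := abs_le.1 (hbd (φ q))
    rcases Int.units_eq_one_or (edgeSign q s) with h' | h' <;> rw [h'] <;> push_cast <;> linarith
  have hsum (s) : ∑ φ, w s φ = 1 := by
    simp only [w]
    rw [← Fintype.prod_sum fun q i => (1 / r + b i * ((edgeSign q s : ℤˣ) : ℤ) : ℝ)]
    refine prod_eq_one fun q _ => ?_
    rw [sum_add_distrib, ← sum_mul, hb]
    simp [hr']
  have hcount (φ : Sym2 (Fin n) → Fin r) :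
      ∑ ψ : Fin p ↪ Fin n, (if Function.Injective (fun e : H.edgeFinset => φ (e.1.map ψ))
        then (1 : ℝ) else 0) ≤ M * Nat.card (H ≃g H) := by
    rw [sum_boole, ← Fintype.card_subtype, ← Nat.card_eq_fintype_card]
    calc _ ≤ ((rainbowCount H (fun q : KEdge n => φ s(q.val.1, q.val.2)) *
          Nat.card (H ≃g H) : ℕ) : ℝ) := by exact_mod_cast card_rainbow_embeddings_le H φ
      _ ≤ _ := by
        push_cast
        exact mul_le_mul_of_nonneg_right (hM _) (Nat.cast_nonneg _)
  have hmain : (2 : ℝ) ^ n * (n.descFactorial p * rainbowDensity H.edgeFinset b) ≤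
      2 ^ n * (M * Nat.card (H ≃g H)) := by
    calc (2 : ℝ) ^ n * (n.descFactorial p * rainbowDensity H.edgeFinset b)
        = ∑ ψ : Fin p ↪ Fin n, ∑ s, ∑ φ, w s φ *
            (if Function.Injective (fun e : H.edgeFinset => φ (e.1.map ψ)) then 1 else 0) := by
          have h (ψ : Fin p ↪ Fin n) : ∑ s, ∑ φ, w s φ *
              (if Function.Injective (fun e : H.edgeFinset => φ (e.1.map ψ)) then 1 else 0) =
              2 ^ n * rainbowDensity H.edgeFinset b := by
            convert sum_sum_prod_weight H.edgeFinset hr b hb ψ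
            simp
          simp_rw [h]
          rw [sum_const, card_univ, Fintype.card_embedding_eq, Fintype.card_fin, Fintype.card_fin,
            nsmul_eq_mul]
          ring
      _ = ∑ s, ∑ φ, w s φ * ∑ ψ : Fin p ↪ Fin n,
            (if Function.Injective (fun e : H.edgeFinset => φ (e.1.map ψ)) then 1 else 0) := by
          rw [sum_comm]
          refine sum_congr rfl fun s _ => ?_
          rw [sum_comm]
          exact sum_congr rfl fun φ _ => (mul_sum _ _ _).symm
      _ ≤ ∑ s, ∑ φ, w s φ * (M * Nat.card (H ≃g H)) :=
          sum_le_sum fun s _ => sum_le_sum fun φ _ =>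
            mul_le_mul_of_nonneg_left (hcount φ) (hw s φ)
      _ = 2 ^ n * (M * Nat.card (H ≃g H)) := by
          simp_rw [← sum_mul, hsum]
          simp
  exact le_of_mul_le_mul_left hmain (by positivity)

/-- **If `H` is `r`-rainbow common for some `r ≥ e(H)`, then `H` is a forest**:
if the limsup over `n` of (the maximum over `r`-colorings `φ` of `E(K_n)` of the number
of rainbow copies of `H` under `φ`) divided by `n ^ v(H)` equals
`(r)_{e(H)} / (r ^ e(H) · |Aut(H)|)`, then `H` contains no cycle. -/
theorem rainbow_common_implies_forest {p : ℕ} (H : SimpleGraph (Fin p))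
    [DecidableRel H.Adj] (r : ℕ) (hr : H.edgeFinset.card ≤ r)
    (hcommon : Filter.atTop.limsup (fun n : ℕ =>
        (⨆ φ : KEdge n → Fin r, (rainbowCount H φ : ℝ)) / (n : ℝ) ^ p) =
      (r.descFactorial H.edgeFinset.card : ℝ) /
        ((r : ℝ) ^ H.edgeFinset.card * (Nat.card (H ≃g H) : ℝ))) :
    H.IsAcyclic := by
  classical
  by_contra hcyc
  obtain ⟨v, c, hc⟩ : ∃ v, ∃ c : H.Walk v v, c.IsCycle := by
    simpa only [SimpleGraph.IsAcyclic, not_forall, not_not] using hcyc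
  have hsub : c.edges.toFinset ⊆ H.edgeFinset := fun e he =>
    SimpleGraph.mem_edgeFinset.2 (c.edges_subset_edgeSet (List.mem_toFinset.1 he))
  have hne : c.edges.toFinset.Nonempty := by
    rw [List.toFinset_nonempty_iff, ← List.length_pos_iff_ne_nil, c.length_edges]
    exact lt_of_lt_of_le (by norm_num) hc.three_le_length
  obtain ⟨b, hb, hbd, hlt⟩ := exists_lt_rainbowDensity H.edgeFinset hr
    (fun e he => H.not_isDiag_of_mem_edgeFinset he)
    ⟨_, hsub, hne, isBalanced_edges_of_isTrail hc.isTrail⟩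
  have hr0 : r ≠ 0 := ((card_pos.2 (hne.mono hsub)).trans_le hr).ne'
  have : NeZero r := ⟨hr0⟩
  have hfin : Finite (H ≃g H) := DFunLike.finite _
  have haut : (0 : ℝ) < Nat.card (H ≃g H) := by
    exact_mod_cast Nat.card_pos_iff.2 ⟨⟨SimpleGraph.Iso.refl⟩, hfin⟩
  have hbdd (n : ℕ) : BddAbove (Set.range fun φ : KEdge n → Fin r => (rainbowCount H φ : ℝ)) :=
    Set.finite_range _ |>.bddAbove
  set a : ℕ → ℝ := fun n => (⨆ φ : KEdge n → Fin r, (rainbowCount H φ : ℝ)) / (n : ℝ) ^ p with ha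
  set D := rainbowDensity H.edgeFinset b
  have hlower (n : ℕ) : (n.descFactorial p : ℝ) / (n : ℝ) ^ p * (D / Nat.card (H ≃g H)) ≤ a n := by
    have h := descFactorial_mul_rainbowDensity_le H hr0 b hb hbd n _ (le_ciSup (hbdd n))
    rw [div_mul_div_comm, mul_comm ((n : ℝ) ^ p), ← div_div]
    exact div_le_div_of_nonneg_right ((div_le_iff₀ haut).2 h) (by positivity)
  have hupper (n : ℕ) : a n ≤ 1 := by
    refine div_le_one_of_le₀ (ciSup_le fun φ => ?_) (by positivity)
    exact_mod_cast rainbowCount_le_pow H φ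
  have htend : Filter.Tendsto
      (fun n : ℕ => (n.descFactorial p : ℝ) / (n : ℝ) ^ p * (D / Nat.card (H ≃g H)))
      Filter.atTop (nhds (D / Nat.card (H ≃g H))) := by
    have h := (Asymptotics.isEquivalent_iff_tendsto_one ?_).1 (isEquivalent_descFactorial p)
    · simpa using h.mul_const (D / Nat.card (H ≃g H) : ℝ)
    · filter_upwards [Filter.eventually_ne_atTop 0] with n hn
      exact pow_ne_zero _ (Nat.cast_ne_zero.2 hn)
  have hLD : (r.descFactorial H.edgeFinset.card : ℝ) /
      ((r : ℝ) ^ H.edgeFinset.card * (Nat.card (H ≃g H) : ℝ)) < D / Nat.card (H ≃g H) := by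
    rw [← div_div]
    exact div_lt_div_of_pos_right hlt haut
  obtain ⟨x, hx1, hx2⟩ := exists_between hLD
  have hx : ∀ᶠ n in Filter.atTop, x ≤ a n := by
    filter_upwards [htend.eventually_const_lt hx2] with n hn
    exact hn.le.trans (hlower n)
  have hle : x ≤ Filter.atTop.limsup a := Filter.le_limsup_of_frequently_le hx.frequently
    (Filter.isBoundedUnder_of ⟨1, hupper⟩)
  exact (hx1.trans_le hle).ne hcommon.symm
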